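/- arXiv:1906.03761 — 4 statements merged into one kernel-verified Lean document; each statement's English description precedes it below -/
import Mathlib

section
/- Let ρ(t) = log(1 + e^t) and let t > 0. The map x ↦ Prox_{tρ}(x) is differentiable on ℝ, and its derivative at x equals 1 / (1 + t·ρ''(Prox_{tρ}(x))), where ρ''(z) = e^z/(1 + e^z)² is the second derivative of ρ. -/
/-- The standard logistic function ρ'(t) = eᵗ/(1 + eᵗ), derivative of ρ(t) = log(1 + eᵗ). -/
noncomputable def rho' (t : ℝ) : ℝ := Real.exp t / (1 + Real.exp t)

/-- ρ''(t) = eᵗ/(1 + eᵗ)², the second derivative of ρ(t) = log(1 + eᵗ). -/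
noncomputable def rho'' (t : ℝ) : ℝ := Real.exp t / (1 + Real.exp t) ^ 2

theorem hasDerivAt_rho' (z : ℝ) : HasDerivAt rho' (rho'' z) z := by
  have hpos : 1 + Real.exp z ≠ 0 := by positivity
  have h := (Real.hasDerivAt_exp z).div ((Real.hasDerivAt_exp z).const_add 1) hpos
  refine h.congr_deriv ?_
  unfold rho''
  ring

theorem rho''_pos (z : ℝ) : 0 < rho'' z := by
  unfold rho''
  positivity

theorem monotone_rho' : Monotone rho' :=
  monotone_of_deriv_nonneg (fun z => (hasDerivAt_rho' z).differentiableAt) fun z => by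
    rw [(hasDerivAt_rho' z).deriv]
    exact (rho''_pos z).le

/-- A right inverse of `z ↦ z + t * g z`, with `g` monotone and `0 ≤ t`, is nonexpansive. -/
theorem lipschitzWith_one_of_add_mul_eq {g P : ℝ → ℝ} {t : ℝ} (hg : Monotone g) (ht : 0 ≤ t)
    (hP : ∀ x, P x + t * g (P x) = x) : LipschitzWith 1 P := by
  refine LipschitzWith.of_dist_le_mul fun x y => ?_
  rw [NNReal.coe_one, one_mul, Real.dist_eq, Real.dist_eq]
  have hx := hP x
  have hy := hP y
  rcases le_total (P x) (P y) with h | h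
  · have := mul_le_mul_of_nonneg_left (hg h) ht
    rw [abs_of_nonpos (by linarith), abs_of_nonpos (by linarith)]
    linarith
  · have := mul_le_mul_of_nonneg_left (hg h) ht
    rw [abs_of_nonneg (by linarith), abs_of_nonneg (by linarith)]
    linarith

/-- Let t > 0 and let P be the proximal map of tρ, characterized by
P x + t·ρ'(P x) = x for all x.  Then P is differentiable, with derivative
1 / (1 + t·ρ''(P x)) at every x. -/
theorem stmt2 (t : ℝ) (ht : 0 < t) (P : ℝ → ℝ)
    (hP : ∀ x : ℝ, P x + t * rho' (P x) = x) (x : ℝ) :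
    HasDerivAt P (1 / (1 + t * rho'' (P x))) x := by
  have hcont := (lipschitzWith_one_of_add_mul_eq monotone_rho' ht.le hP).continuous
  have hderiv : HasDerivAt (fun z => z + t * rho' z) (1 + t * rho'' (P x)) (P x) :=
    (hasDerivAt_id' (P x)).add ((hasDerivAt_rho' (P x)).const_mul t)
  have hpos : 0 < t * rho'' (P x) := mul_pos ht (rho''_pos (P x))
  rw [one_div]
  exact hderiv.of_local_left_inverse hcont.continuousAt (by linarith)
    (Filter.Eventually.of_forall hP)
end

section
/- Let Φ : ℝ → ℝ be a convex function and let v ∈ ℝ. Then the Moreau envelope t ↦ M_Φ(v, t) = min_{x ∈ ℝ} [Φ(x) + (x − v)²/(2t)] is differentiable on (0, ∞), with derivative ∂M_Φ/∂t (v, t) = −(v − Prox_{tΦ}(v))² / (2t²). -/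
open Asymptotics Topology in
/-- A function dominated by a quadratic near `t` has zero derivative there. -/
theorem hasDerivAt_zero_of_eventually_abs_le_sq {f : ℝ → ℝ} {t C : ℝ}
    (h : ∀ᶠ s in 𝓝 t, |f s| ≤ C * (s - t) ^ 2) : HasDerivAt f 0 t := by
  have hO : f =O[𝓝 t] fun s => ‖s - t‖ ^ 2 := by
    refine IsBigO.of_bound C ?_
    filter_upwards [h] with s hs
    simpa using hs
  simpa using (hO.hasFDerivAt (by norm_num)).hasDerivAt

/-- The optimality condition for the proximal point: `(v - a) / t` is a subgradient at `a`. -/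
theorem ConvexOn.subgradient_of_isMinOn_prox {Φ : ℝ → ℝ} (hΦ : ConvexOn ℝ Set.univ Φ)
    {v t a : ℝ} (ht : 0 < t)
    (ha : IsMinOn (fun x : ℝ => Φ x + (x - v) ^ 2 / (2 * t)) Set.univ a) (y : ℝ) :
    Φ a + (v - a) / t * (y - a) ≤ Φ y := by
  by_contra! hlt
  have key : ∀ l : ℝ, 0 < l → l ≤ 1 →
      Φ a + (v - a) / t * (y - a) - Φ y ≤ l * ((y - a) ^ 2 / (2 * t)) := by
    intro l hl hl1
    have hmin : Φ a + (a - v) ^ 2 / (2 * t) ≤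
        Φ ((1 - l) * a + l * y) + ((1 - l) * a + l * y - v) ^ 2 / (2 * t) :=
      ha (Set.mem_univ ((1 - l) * a + l * y))
    have hconv := hΦ.2 (Set.mem_univ a) (Set.mem_univ y) (sub_nonneg.2 hl1) hl.le
      (sub_add_cancel 1 l)
    simp only [smul_eq_mul] at hconv
    have hexpand : ((1 - l) * a + l * y - v) ^ 2 / (2 * t) = (a - v) ^ 2 / (2 * t)
        - l * ((v - a) / t * (y - a)) + l * (l * ((y - a) ^ 2 / (2 * t))) := by
      field_simp
      ring
    refine le_of_mul_le_mul_left ?_ hl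
    linarith
  set X := Φ a + (v - a) / t * (y - a) - Φ y with hX
  set Y := (y - a) ^ 2 / (2 * t)
  have hXpos : 0 < X := by linarith
  have hY : 0 ≤ Y := by positivity
  have h := key (X / (X + Y)) (by positivity) ((div_le_one (by positivity)).2 (by linarith))
  rw [div_mul_eq_mul_div, le_div_iff₀ (by positivity)] at h
  nlinarith

/-- The proximal point depends on the parameter in a Lipschitz way. -/
theorem ConvexOn.abs_prox_sub_prox_le {Φ : ℝ → ℝ} (hΦ : ConvexOn ℝ Set.univ Φ)
    {v s t a b : ℝ} (hs : 0 < s) (ht : 0 < t)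
    (ha : IsMinOn (fun x : ℝ => Φ x + (x - v) ^ 2 / (2 * t)) Set.univ a)
    (hb : IsMinOn (fun x : ℝ => Φ x + (x - v) ^ 2 / (2 * s)) Set.univ b) :
    |b - a| ≤ |a - v| * (|s - t| / t) := by
  have h1 := hΦ.subgradient_of_isMinOn_prox ht ha b
  have h2 := hΦ.subgradient_of_isMinOn_prox hs hb a
  have h3 : (b - a) ^ 2 ≤ (a - v) * ((s - t) / t) * (b - a) := by
    have h4 : s * ((v - a) / t * (b - a) + (v - b) / s * (a - b)) ≤ 0 :=
      mul_nonpos_of_nonneg_of_nonpos hs.le (by linarith)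
    have h5 : s * ((v - a) / t * (b - a) + (v - b) / s * (a - b)) =
        (b - a) ^ 2 - (a - v) * ((s - t) / t) * (b - a) := by
      field_simp
      ring
    linarith
  have h6 : |b - a| * |b - a| ≤ |a - v| * (|s - t| / t) * |b - a| := by
    calc |b - a| * |b - a| = (b - a) ^ 2 := by rw [abs_mul_abs_self, sq]
      _ ≤ |(a - v) * ((s - t) / t) * (b - a)| := h3.trans (le_abs_self _)
      _ = _ := by rw [abs_mul, abs_mul, abs_div, abs_of_pos ht]
  rcases eq_or_ne b a with h | h
  · simp only [h, sub_self, abs_zero]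
    positivity
  · exact le_of_mul_le_mul_right h6 (abs_pos.2 (sub_ne_zero.2 h))


/-- For a convex Φ : ℝ → ℝ and fixed v, let P t = Prox_{tΦ}(v) for t > 0 (a minimizer of
x ↦ Φ(x) + (x − v)²/(2t)).  Then the Moreau envelope t ↦ M_Φ(v, t) = Φ(P t) + (P t − v)²/(2t)
is differentiable on (0, ∞) with derivative −(v − P t)²/(2t²). -/
theorem stmt4 (Φ : ℝ → ℝ) (hΦ : ConvexOn ℝ Set.univ Φ) (v : ℝ)
    (P : ℝ → ℝ)
    (hP : ∀ t : ℝ, 0 < t →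
      IsMinOn (fun x : ℝ => Φ x + (x - v) ^ 2 / (2 * t)) Set.univ (P t)) :
    ∀ t : ℝ, 0 < t →
      HasDerivWithinAt (fun s : ℝ => Φ (P s) + (P s - v) ^ 2 / (2 * s))
        (-(v - P t) ^ 2 / (2 * t ^ 2)) (Set.Ioi (0 : ℝ)) t := by
  intro t ht
  refine HasDerivAt.hasDerivWithinAt ?_
  set M := fun s : ℝ => Φ (P s) + (P s - v) ^ 2 / (2 * s) with hM
  have hbound : ∀ᶠ s in nhds t, |M s - M t - (P t - v) ^ 2 / 2 * (s⁻¹ - t⁻¹)| ≤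
      (P t - v) ^ 2 * (3 / t ^ 3) * (s - t) ^ 2 := by
    filter_upwards [Ioo_mem_nhds (half_lt_self ht) (lt_two_mul_self ht)] with s hs
    have hs0 : 0 < s := (half_pos ht).trans hs.1
    have hup : Φ (P s) + (P s - v) ^ 2 / (2 * s) ≤ Φ (P t) + (P t - v) ^ 2 / (2 * s) :=
      hP s hs0 (Set.mem_univ (P t))
    have hlow : Φ (P t) + (P t - v) ^ 2 / (2 * t) ≤ Φ (P s) + (P s - v) ^ 2 / (2 * t) :=
      hP t ht (Set.mem_univ (P s))
    have hlip := hΦ.abs_prox_sub_prox_le hs0 ht (hP t ht) (hP s hs0)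
    have hdiv : ∀ x r : ℝ, x / (2 * r) = x / 2 * r⁻¹ := fun x r => by
      rw [← div_div, div_eq_mul_inv (x / 2)]
    simp only [hM]
    rw [hdiv] at hup hlow
    simp only [hdiv] at hup hlow ⊢
    have hD : |Φ (P s) + (P s - v) ^ 2 / 2 * s⁻¹ - (Φ (P t) + (P t - v) ^ 2 / 2 * t⁻¹)
        - (P t - v) ^ 2 / 2 * (s⁻¹ - t⁻¹)| ≤
        |((P s - v) ^ 2 - (P t - v) ^ 2) / 2 * (s⁻¹ - t⁻¹)| := by
      rw [abs_of_nonpos (by linarith)]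
      refine le_trans ?_ (neg_le_abs _)
      linarith
    have hr : |s - t| / t ≤ 1 := by
      rw [div_le_one ht, abs_le]
      constructor <;> linarith [hs.1, hs.2]
    have hsq : |(P s - v) ^ 2 - (P t - v) ^ 2| ≤ 3 * (P t - v) ^ 2 * (|s - t| / t) := by
      have hsum : |P s - P t + 2 * (P t - v)| ≤ 3 * |P t - v| := by
        refine (abs_add_le _ _).trans ?_
        rw [abs_mul, abs_two]
        linarith [mul_le_of_le_one_right (abs_nonneg (P t - v)) hr]
      calc |(P s - v) ^ 2 - (P t - v) ^ 2|
          = |P s - P t| * |P s - P t + 2 * (P t - v)| := by rw [← abs_mul]; ring_nf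
        _ ≤ |P t - v| * (|s - t| / t) * (3 * |P t - v|) := by gcongr
        _ = 3 * |P t - v| ^ 2 * (|s - t| / t) := by ring
        _ = _ := by rw [sq_abs]
    have hinv : |s⁻¹ - t⁻¹| ≤ 2 * |s - t| / t ^ 2 := by
      rw [inv_sub_inv hs0.ne' ht.ne', abs_div, abs_of_pos (mul_pos hs0 ht), abs_sub_comm t s,
        div_le_div_iff₀ (by positivity) (by positivity)]
      have : t ^ 2 ≤ 2 * (s * t) := by nlinarith [hs.1]
      nlinarith [abs_nonneg (s - t)]
    refine hD.trans ?_
    rw [abs_mul, abs_div, abs_two]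
    calc _ ≤ 3 * (P t - v) ^ 2 * (|s - t| / t) / 2 * (2 * |s - t| / t ^ 2) := by gcongr
      _ = (P t - v) ^ 2 * (3 / t ^ 3) * |s - t| ^ 2 := by field_simp
      _ = _ := by rw [sq_abs]
  have hderiv := ((hasDerivAt_zero_of_eventually_abs_le_sq hbound).add
    (((hasDerivAt_inv ht.ne').sub_const t⁻¹).const_mul ((P t - v) ^ 2 / 2))).add_const (M t)
  convert hderiv using 1
  · ext s
    simp
  · field_simp
    ring
end

section
/- Let Z be a standard normal random variable and let v, c > 0. Then E[Z·η(vZ, c)] = 2v·Q(c/v), where η(x, t) = sign(x)·max(|x| − t, 0) is the soft-thresholding function and Q(t) = ∫_t^∞ e^{−x²/2}/√(2π) dx is the Gaussian tail function. -/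
/-- The soft-thresholding function η(x, t) = sign(x)·max(|x| − t, 0). -/
noncomputable def softThresh (x t : ℝ) : ℝ := Real.sign x * max (|x| - t) 0

/-- The Gaussian tail function Q(t) = ∫_t^∞ e^{−x²/2}/√(2π) dx. -/
noncomputable def gaussQ (t : ℝ) : ℝ :=
  ∫ x in Set.Ioi t, Real.exp (-x ^ 2 / 2) / Real.sqrt (2 * Real.pi)

open MeasureTheory in
/-- Gaussian integration by parts on a half-line, for an affine function vanishing at its endpoint. -/
lemma integral_Ioi_mul_affine_mul_exp_neg_sq_div_two {v c : ℝ} (hv : v ≠ 0) :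
    ∫ x in Set.Ioi (c / v), x * (v * x - c) * Real.exp (-x ^ 2 / 2)
      = v * ∫ x in Set.Ioi (c / v), Real.exp (-x ^ 2 / 2) := by
  have hb : (0 : ℝ) < 1 / 2 := by norm_num
  have h0 : Integrable fun x : ℝ => Real.exp (-x ^ 2 / 2) := by
    convert integrable_exp_neg_mul_sq hb using 3
    ring
  have h1 : Integrable fun x : ℝ => x * Real.exp (-x ^ 2 / 2) := by
    convert integrable_mul_exp_neg_mul_sq hb using 4
    ring
  have h2 : Integrable fun x : ℝ => x ^ 2 * Real.exp (-x ^ 2 / 2) := by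
    convert integrable_rpow_mul_exp_neg_mul_sq hb (s := 2) (by norm_num) using 3
    · norm_cast
    · ring_nf
  have hg : Integrable fun x : ℝ => x * (v * x - c) * Real.exp (-x ^ 2 / 2) := by
    convert (h2.const_mul v).sub (h1.const_mul c) using 2
    simp only [Pi.sub_apply]
    ring
  have hf : Integrable fun x : ℝ => -((v * x - c) * Real.exp (-x ^ 2 / 2)) := by
    convert (h0.const_mul c).sub (h1.const_mul v) using 2
    simp only [Pi.sub_apply]
    ring
  have hf' : Integrable fun x : ℝ =>
      x * (v * x - c) * Real.exp (-x ^ 2 / 2) - v * Real.exp (-x ^ 2 / 2) :=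
    hg.sub (h0.const_mul v)
  have hd (x : ℝ) : HasDerivAt (fun x : ℝ => -((v * x - c) * Real.exp (-x ^ 2 / 2)))
      (x * (v * x - c) * Real.exp (-x ^ 2 / 2) - v * Real.exp (-x ^ 2 / 2)) x := by
    refine ((((hasDerivAt_id' x).const_mul v).sub_const c).fun_mul
      ((hasDerivAt_pow 2 x).fun_neg.div_const 2).exp).fun_neg.congr_deriv ?_
    push_cast
    ring
  have key := integral_Ioi_of_hasDerivAt_of_tendsto' (a := c / v) (fun x _ => hd x)
    hf'.integrableOn (tendsto_zero_of_hasDerivAt_of_integrableOn_Ioi (a := c / v)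
      (fun x _ => hd x) hf'.integrableOn hf.integrableOn)
  rw [integral_sub hg.integrableOn (h0.const_mul v).integrableOn, integral_const_mul,
    mul_div_cancel₀ c hv] at key
  linarith

/-- By oddness of soft-thresholding, `z * softThresh (v * z) c` depends only on `|z|`. -/
lemma mul_softThresh_mul {v : ℝ} (hv : 0 < v) (z c : ℝ) :
    z * softThresh (v * z) c = |z| * max (v * |z| - c) 0 := by
  rw [softThresh, abs_mul, abs_of_pos hv]
  rcases lt_trichotomy z 0 with h | rfl | h
  · rw [Real.sign_of_neg (mul_neg_of_pos_of_neg hv h), abs_of_neg h]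
    ring
  · simp
  · rw [Real.sign_of_pos (mul_pos hv h), abs_of_pos h]
    ring

/-- For a standard normal Z and v, c > 0: E[Z·η(vZ, c)] = 2v·Q(c/v). -/
theorem stmt13 (v c : ℝ) (hv : 0 < v) (hc : 0 < c) :
    ∫ z : ℝ, z * softThresh (v * z) c *
        (Real.exp (-z ^ 2 / 2) / Real.sqrt (2 * Real.pi))
      = 2 * v * gaussQ (c / v) := by
  let f (x : ℝ) := x * max (v * x - c) 0 * Real.exp (-x ^ 2 / 2) / Real.sqrt (2 * Real.pi)
  have habs (z : ℝ) : z * softThresh (v * z) c *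
      (Real.exp (-z ^ 2 / 2) / Real.sqrt (2 * Real.pi)) = f |z| := by
    simp only [f, mul_softThresh_mul hv, sq_abs, mul_div_assoc]
  have hsub : Set.Ioi (c / v) ⊆ Set.Ioi 0 := Set.Ioi_subset_Ioi (div_pos hc hv).le
  have hind : ∫ x in Set.Ioi 0, x * max (v * x - c) 0 * Real.exp (-x ^ 2 / 2) =
      ∫ x in Set.Ioi (c / v), x * (v * x - c) * Real.exp (-x ^ 2 / 2) := by
    rw [MeasureTheory.setIntegral_eq_of_subset_of_forall_sdiff_eq_zero measurableSet_Ioi hsub]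
    · refine MeasureTheory.setIntegral_congr_fun measurableSet_Ioi fun x hx => ?_
      have : c < v * x := (div_lt_iff₀' hv).1 hx
      simp only [max_eq_left (sub_nonneg.2 this.le)]
    · intro x hx
      have : v * x ≤ c := (le_div_iff₀' hv).1 (not_lt.1 hx.2)
      simp [max_eq_right (sub_nonpos.2 this)]
  simp_rw [habs]
  rw [integral_comp_abs (f := f), MeasureTheory.integral_div, hind,
    integral_Ioi_mul_affine_mul_exp_neg_sq_div_two hv.ne', gaussQ, MeasureTheory.integral_div]
  ring
end

section
/- Let κ, δ, σ, τ, r, λ > 0, θ ∈ ℝ, s ∈ (0, 1). Let Z be a standard normal random variable and let β be independent of Z with the sparse distribution Π: β = 0 with probability 1 − s, and conditional on being nonzero β is Gaussian with mean 0 and variance κ²/s. Then E[β·η(στ(θβ + (r/√δ)Z), λστ)] = 2στθκ²·Q(t₁), where t₁ = λ/√(r²/δ + θ²κ²/s), η(x, t) = sign(x)·max(|x| − t, 0) is soft-thresholding, and Q is the Gaussian tail function. -/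
open MeasureTheory ProbabilityTheory

/-- The sparse prior Π = (1 − s)·δ₀ + s·N(0, κ²/s). -/
noncomputable def sparseDist (s κ : ℝ) : Measure ℝ :=
  ENNReal.ofReal (1 - s) • Measure.dirac (0 : ℝ) +
    ENNReal.ofReal s • gaussianReal 0 ((κ ^ 2 / s).toNNReal)

lemma softThresh_eq_max_sub_max {t : ℝ} (ht : 0 ≤ t) (x : ℝ) :
    softThresh x t = max (x - t) 0 - max (-x - t) 0 := by
  unfold softThresh
  rcases lt_trichotomy x 0 with hx | rfl | hx
  · rw [Real.sign_of_neg hx, abs_of_neg hx, max_eq_right (a := x - t) (by linarith)]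
    ring
  · simp
  · rw [Real.sign_of_pos hx, abs_of_pos hx, max_eq_right (a := -x - t) (by linarith)]
    ring

lemma continuous_softThresh {t : ℝ} (ht : 0 ≤ t) : Continuous fun x ↦ softThresh x t := by
  simp_rw [softThresh_eq_max_sub_max ht]
  fun_prop

lemma abs_softThresh_le {t : ℝ} (ht : 0 ≤ t) (x : ℝ) : |softThresh x t| ≤ |x| := by
  rw [softThresh_eq_max_sub_max ht]
  grind

lemma softThresh_mul_mul {c t : ℝ} (hc : 0 ≤ c) (ht : 0 ≤ t) (x : ℝ) :
    softThresh (c * x) (c * t) = c * softThresh x t := by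
  rw [softThresh_eq_max_sub_max ht, softThresh_eq_max_sub_max (by positivity), mul_sub,
    mul_max_of_nonneg _ _ hc, mul_max_of_nonneg _ _ hc]
  ring_nf

lemma mul_softThresh {t : ℝ} (x : ℝ) :
    x * softThresh x t = |x| * max (|x| - t) 0 := by
  unfold softThresh
  rw [← mul_assoc]
  rcases lt_trichotomy x 0 with hx | rfl | hx
  · rw [Real.sign_of_neg hx, abs_of_neg hx]
    ring
  · simp
  · rw [Real.sign_of_pos hx, abs_of_pos hx]
    ring

lemma integrable_exp_neg_sq_half : Integrable fun x : ℝ ↦ Real.exp (-x ^ 2 / 2) := by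
  convert! integrable_exp_neg_mul_sq (b := 1 / 2) (by norm_num) using 3
  ring

lemma integrable_mul_exp_neg_sq_half : Integrable fun x : ℝ ↦ x * Real.exp (-x ^ 2 / 2) := by
  convert! integrable_mul_exp_neg_mul_sq (b := 1 / 2) (by norm_num) using 4
  ring

lemma integrable_sq_mul_exp_neg_sq_half :
    Integrable fun x : ℝ ↦ x ^ 2 * Real.exp (-x ^ 2 / 2) := by
  convert! integrable_rpow_mul_exp_neg_mul_sq (b := 1 / 2) (by norm_num) (s := 2)
    (by norm_num) using 3
  · exact (Real.rpow_two _).symm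
  · ring_nf

/-- Integration by parts for the Gaussian weight on a half-line. -/
lemma integral_Ioi_mul_sub_mul_exp (t : ℝ) :
    ∫ x in Set.Ioi t, x * (x - t) * Real.exp (-x ^ 2 / 2) =
      ∫ x in Set.Ioi t, Real.exp (-x ^ 2 / 2) := by
  have hd (x : ℝ) : HasDerivAt (fun x ↦ -((x - t) * Real.exp (-x ^ 2 / 2)))
      (x * (x - t) * Real.exp (-x ^ 2 / 2) - Real.exp (-x ^ 2 / 2)) x := by
    have h1 : HasDerivAt (fun x : ℝ ↦ -x ^ 2 / 2) (-x) x := by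
      convert! ((hasDerivAt_pow 2 x).neg.div_const 2) using 1
      simp only [Nat.cast_ofNat]
      ring
    convert! ((((hasDerivAt_id x).sub_const t).mul h1.exp)).neg using 1
    simp only [id]
    ring
  have hi : Integrable fun x : ℝ ↦ x * (x - t) * Real.exp (-x ^ 2 / 2) := by
    convert! integrable_sq_mul_exp_neg_sq_half.sub (integrable_mul_exp_neg_sq_half.const_mul t)
      using 2
    simp only [Pi.sub_apply]
    ring
  have hF : Integrable fun x : ℝ ↦ -((x - t) * Real.exp (-x ^ 2 / 2)) := by
    convert! ((integrable_exp_neg_sq_half.const_mul t).sub integrable_mul_exp_neg_sq_half) using 2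
    simp only [Pi.sub_apply]
    ring
  have hi' := hi.sub integrable_exp_neg_sq_half
  have h0 := tendsto_zero_of_hasDerivAt_of_integrableOn_Ioi (a := t) (fun x _ ↦ hd x)
    hi'.integrableOn hF.integrableOn
  have h := integral_Ioi_of_hasDerivAt_of_tendsto' (a := t) (fun x _ ↦ hd x) hi'.integrableOn h0
  rw [integral_sub hi.integrableOn integrable_exp_neg_sq_half.integrableOn] at h
  simp only [sub_self, zero_mul, neg_zero] at h
  linarith

lemma integral_mul_softThresh_gaussianReal {t : ℝ} (ht : 0 ≤ t) :
    ∫ x, x * softThresh x t ∂(gaussianReal 0 1) = 2 * gaussQ t := by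
  have h1 : ∫ x, x * softThresh x t ∂(gaussianReal 0 1) =
      ∫ x : ℝ, (√(2 * Real.pi))⁻¹ * (|x| * max (|x| - t) 0 * Real.exp (-|x| ^ 2 / 2)) := by
    rw [integral_gaussianReal_eq_integral_smul one_ne_zero]
    refine integral_congr_ae (.of_forall fun x ↦ ?_)
    simp only [gaussianPDFReal, mul_softThresh, smul_eq_mul, NNReal.coe_one, mul_one, sub_zero,
      sq_abs]
    ring
  rw [h1, integral_const_mul, integral_comp_abs
    (f := fun x ↦ x * max (x - t) 0 * Real.exp (-x ^ 2 / 2))]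
  have h2 : ∫ x in Set.Ioi (0 : ℝ), x * max (x - t) 0 * Real.exp (-x ^ 2 / 2) =
      ∫ x in Set.Ioi t, x * (x - t) * Real.exp (-x ^ 2 / 2) := by
    rw [setIntegral_eq_of_subset_of_forall_sdiff_eq_zero measurableSet_Ioi
      (Set.Ioi_subset_Ioi ht)]
    · refine setIntegral_congr_fun measurableSet_Ioi fun x hx ↦ ?_
      rw [Set.mem_Ioi] at hx
      simp only [max_eq_left (sub_nonneg.2 hx.le)]
    · intro x hx
      simp only [Set.mem_sdiff, Set.mem_Ioi, not_lt] at hx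
      rw [max_eq_right (sub_nonpos.2 hx.2), mul_zero, zero_mul]
  rw [h2, integral_Ioi_mul_sub_mul_exp, gaussQ, integral_div]
  ring

/-- A bivariate Gaussian regression identity: the component of `x` orthogonal to `A x + B z`
does not contribute to the expectation. -/
lemma integral_fst_mul_comp_linear {A B R : ℝ} (hR : √(A ^ 2 + B ^ 2) = R) (hR0 : R ≠ 0)
    {f : ℝ → ℝ} (hf : Continuous f)
    (hf0 : Integrable (fun u ↦ f (R * u)) (gaussianReal 0 1))
    (hf1 : Integrable (fun u ↦ u * f (R * u)) (gaussianReal 0 1)) :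
    ∫ p : ℝ × ℝ, p.1 * f (A * p.1 + B * p.2) ∂((gaussianReal 0 1).prod (gaussianReal 0 1)) =
      A / R * ∫ u, u * f (R * u) ∂(gaussianReal 0 1) := by
  obtain ⟨φ, hA, hB⟩ : ∃ φ, A = R * Real.cos φ ∧ B = R * Real.sin φ := by
    have hn : ‖(⟨A, B⟩ : ℂ)‖ = R := by
      rw [Complex.norm_def, Complex.normSq_mk, ← hR]
      ring_nf
    refine ⟨Complex.arg ⟨A, B⟩, ?_, ?_⟩
    · rw [← hn, Complex.norm_mul_cos_arg]
    · rw [← hn, Complex.norm_mul_sin_arg]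
  have hrot := IsGaussian.map_rotation_eq_self (μ := gaussianReal 0 1)
    (by simp [integral_id_gaussianReal]) φ
  have hcs := Real.cos_sq_add_sin_sq φ
  have hid : Integrable (fun u : ℝ ↦ u) (gaussianReal 0 1) :=
    (memLp_id_gaussianReal 1).integrable (by simp)
  calc _ = ∫ p : ℝ × ℝ, (Real.cos φ * (ContinuousLinearMap.rotation φ p).1
            - Real.sin φ * (ContinuousLinearMap.rotation φ p).2)
            * f (R * (ContinuousLinearMap.rotation φ p).1)
            ∂((gaussianReal 0 1).prod (gaussianReal 0 1)) := by
        congr 1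
        ext p
        simp only [ContinuousLinearMap.rotation_apply, smul_eq_mul]
        rw [hA, hB]
        congr 1
        · linear_combination -p.1 * hcs
        · congr 1
          ring
    _ = ∫ q : ℝ × ℝ, (Real.cos φ * q.1 - Real.sin φ * q.2) * f (R * q.1)
            ∂((gaussianReal 0 1).prod (gaussianReal 0 1)) := by
        conv_rhs => rw [← hrot]
        rw [integral_map (by fun_prop) (Continuous.aestronglyMeasurable (by fun_prop))]
    _ = ∫ q : ℝ × ℝ, (Real.cos φ * ((q.1 * f (R * q.1)) * 1)
            - Real.sin φ * (f (R * q.1) * q.2))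
            ∂((gaussianReal 0 1).prod (gaussianReal 0 1)) := by
        congr 1
        ext q
        ring
    _ = _ := by
        rw [integral_sub ((hf1.mul_prod (integrable_const 1)).const_mul _)
          ((hf0.mul_prod hid).const_mul _), integral_const_mul, integral_const_mul,
          integral_prod_mul (fun u ↦ u * f (R * u)) (fun _ ↦ (1 : ℝ)),
          integral_prod_mul (fun u ↦ f (R * u)) (fun u ↦ u), integral_id_gaussianReal, hA,
          mul_div_cancel_left₀ _ hR0]
        simp

lemma integral_fst_mul_softThresh_gaussianReal {A B t : ℝ} (hB : 0 < B) (ht : 0 ≤ t) :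
    ∫ p : ℝ × ℝ, p.1 * softThresh (A * p.1 + B * p.2) t
        ∂((gaussianReal 0 1).prod (gaussianReal 0 1)) =
      2 * A * gaussQ (t / √(A ^ 2 + B ^ 2)) := by
  set R := √(A ^ 2 + B ^ 2) with hR
  have hR0 : 0 < R := by positivity
  have hscale (u : ℝ) : softThresh (R * u) t = R * softThresh u (t / R) := by
    rw [← softThresh_mul_mul hR0.le (by positivity), mul_div_cancel₀ _ hR0.ne']
  have htR : 0 ≤ t / R := by positivity
  have hid : Integrable (fun u : ℝ ↦ u) (gaussianReal 0 1) :=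
    (memLp_id_gaussianReal 1).integrable (by simp)
  have hsq : Integrable (fun u : ℝ ↦ u ^ 2) (gaussianReal 0 1) :=
    (memLp_id_gaussianReal 2).integrable_sq
  have hc := continuous_softThresh htR
  have hi0 : Integrable (fun u ↦ softThresh u (t / R)) (gaussianReal 0 1) :=
    hid.mono hc.aestronglyMeasurable (.of_forall fun u ↦ abs_softThresh_le htR u)
  have hi1 : Integrable (fun u ↦ u * softThresh u (t / R)) (gaussianReal 0 1) := by
    refine hsq.mono (Continuous.aestronglyMeasurable (by fun_prop)) (.of_forall fun u ↦ ?_)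
    rw [norm_mul, norm_pow, sq]
    exact mul_le_mul_of_nonneg_left (abs_softThresh_le htR u) (norm_nonneg u)
  have hmul (u : ℝ) : u * (R * softThresh u (t / R)) = R * (u * softThresh u (t / R)) := by ring
  rw [integral_fst_mul_comp_linear (f := fun x ↦ softThresh x t) hR.symm hR0.ne'
    (continuous_softThresh ht)]
  · simp_rw [hscale, hmul]
    rw [integral_const_mul, integral_mul_softThresh_gaussianReal htR]
    field_simp
  · simp_rw [hscale]
    exact hi0.const_mul R
  · simp_rw [hscale, hmul]
    exact hi1.const_mul R

lemma integrable_fst_mul_softThresh_gaussianReal (A B : ℝ) {t : ℝ} (ht : 0 ≤ t) :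
    Integrable (fun p : ℝ × ℝ ↦ p.1 * softThresh (A * p.1 + B * p.2) t)
      ((gaussianReal 0 1).prod (gaussianReal 0 1)) := by
  have hid : Integrable (fun u : ℝ ↦ u) (gaussianReal 0 1) :=
    (memLp_id_gaussianReal 1).integrable (by simp)
  have hsq : Integrable (fun u : ℝ ↦ u ^ 2) (gaussianReal 0 1) :=
    (memLp_id_gaussianReal 2).integrable_sq
  have hc := continuous_softThresh ht
  have hdom : Integrable (fun p : ℝ × ℝ ↦ |A| * (p.1 ^ 2 * 1) + |B| * (|p.1| * |p.2|))
      ((gaussianReal 0 1).prod (gaussianReal 0 1)) :=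
    ((hsq.mul_prod (integrable_const 1)).const_mul _).add ((hid.abs.mul_prod hid.abs).const_mul _)
  refine hdom.mono' (Continuous.aestronglyMeasurable (by fun_prop)) (.of_forall fun p ↦ ?_)
  rw [Real.norm_eq_abs, abs_mul]
  calc |p.1| * |softThresh (A * p.1 + B * p.2) t|
      ≤ |p.1| * (|A| * |p.1| + |B| * |p.2|) := by
        refine mul_le_mul_of_nonneg_left ((abs_softThresh_le ht _).trans ?_) (abs_nonneg _)
        rw [← abs_mul, ← abs_mul]
        exact abs_add_le _ _
    _ = |A| * (p.1 ^ 2 * 1) + |B| * (|p.1| * |p.2|) := by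
        rw [← sq_abs p.1]
        ring

/-- Integrating against the sparse prior a function vanishing at `0` in the first variable only
sees the Gaussian component, which is a scaled standard Gaussian. -/
lemma integral_sparseDist_prod {s κ : ℝ} (hs0 : 0 < s) {g : ℝ × ℝ → ℝ}
    (hg : Continuous g) (hg0 : ∀ z, g (0, z) = 0) (ν : Measure ℝ) [IsProbabilityMeasure ν]
    (hi : Integrable (fun p : ℝ × ℝ ↦ g (√(κ ^ 2 / s) * p.1, p.2)) ((gaussianReal 0 1).prod ν)) :
    ∫ p, g p ∂((sparseDist s κ).prod ν) =
      s * ∫ p : ℝ × ℝ, g (√(κ ^ 2 / s) * p.1, p.2) ∂((gaussianReal 0 1).prod ν) := by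
  have hmap : (gaussianReal 0 (κ ^ 2 / s).toNNReal).prod ν =
      ((gaussianReal 0 1).prod ν).map (fun p : ℝ × ℝ ↦ (√(κ ^ 2 / s) * p.1, p.2)) := by
    have h := gaussianReal_map_const_mul (μ := 0) (v := 1) √(κ ^ 2 / s)
    have hv : NNReal.mk (√(κ ^ 2 / s) ^ 2) (sq_nonneg _) * 1 = (κ ^ 2 / s).toNNReal := by
      ext
      simp [Real.sq_sqrt (show 0 ≤ κ ^ 2 / s by positivity), show 0 ≤ κ ^ 2 / s by positivity]
    rw [mul_zero, hv] at h
    conv_lhs => rw [← h, ← Measure.map_id (μ := ν)]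
    rw [Measure.map_prod_map _ _ (by fun_prop) (by fun_prop)]
    rfl
  have hgauss : Integrable g ((gaussianReal 0 (κ ^ 2 / s).toNNReal).prod ν) := by
    rw [hmap]
    exact (integrable_map_measure hg.aestronglyMeasurable (by fun_prop)).2 hi
  have hzero : g =ᵐ[(Measure.dirac (0 : ℝ)).prod ν] 0 := by
    rw [Measure.dirac_prod]
    exact (ae_map_iff (by fun_prop) (measurableSet_eq_fun hg.measurable measurable_const)).2
      (.of_forall hg0)
  have hdirac : Integrable g ((Measure.dirac (0 : ℝ)).prod ν) :=
    (integrable_zero _ _ _).congr hzero.symm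
  rw [sparseDist, Measure.add_prod, Measure.prod_smul_left, Measure.prod_smul_left,
    integral_add_measure (hdirac.smul_measure ENNReal.ofReal_ne_top)
      (hgauss.smul_measure ENNReal.ofReal_ne_top), integral_smul_measure, integral_smul_measure,
    integral_congr_ae hzero, hmap, integral_map (by fun_prop) hg.aestronglyMeasurable,
    ENNReal.toReal_ofReal hs0.le]
  simp

/-- With β ∼ Π (sparse prior) independent of Z standard normal:
E[β·η(στ(θβ + (r/√δ)Z), λστ)] = 2στθκ²·Q(t₁), where t₁ = λ/√(r²/δ + θ²κ²/s). -/
theorem stmt15 (κ δ σ τ r lam θ s : ℝ)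
    (hκ : 0 < κ) (hδ : 0 < δ) (hσ : 0 < σ) (hτ : 0 < τ) (hr : 0 < r) (hlam : 0 < lam)
    (hs0 : 0 < s) (hs1 : s < 1) :
    ∫ p : ℝ × ℝ,
        p.1 * softThresh (σ * τ * (θ * p.1 + (r / Real.sqrt δ) * p.2)) (lam * σ * τ)
        ∂((sparseDist s κ).prod (gaussianReal 0 1))
      = 2 * σ * τ * θ * κ ^ 2 *
          gaussQ (lam / Real.sqrt (r ^ 2 / δ + θ ^ 2 * κ ^ 2 / s)) := by
  set v := κ ^ 2 / s with hv
  have hv0 : 0 < v := by positivity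
  have hvs := Real.sq_sqrt hv0.le
  have hδs := Real.sq_sqrt hδ.le
  have hστ : 0 < σ * τ := mul_pos hσ hτ
  have ht : 0 ≤ lam * σ * τ := by positivity
  have hc := continuous_softThresh ht
  have hlin (p : ℝ × ℝ) : √v * p.1 * softThresh (σ * τ * (θ * (√v * p.1) + r / √δ * p.2))
      (lam * σ * τ) = √v * (p.1 * softThresh (σ * τ * θ * √v * p.1 + σ * τ * (r / √δ) * p.2)
        (lam * σ * τ)) := by
    rw [mul_assoc]
    ring_nf
  rw [integral_sparseDist_prod (κ := κ) hs0 (by fun_prop) (by simp)]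
  · simp_rw [← hv, hlin]
    rw [integral_const_mul, integral_fst_mul_softThresh_gaussianReal (by positivity) ht]
    have hR : √((σ * τ * θ * √v) ^ 2 + (σ * τ * (r / √δ)) ^ 2) =
        σ * τ * √(r ^ 2 / δ + θ ^ 2 * κ ^ 2 / s) := by
      rw [← Real.sqrt_sq hστ.le, ← Real.sqrt_mul (sq_nonneg _), Real.sqrt_sq hστ.le]
      congr 1
      rw [mul_pow _ √v, hvs, mul_pow _ (r / √δ), div_pow, hδs, hv]
      ring
    rw [hR, show lam * σ * τ / (σ * τ * √(r ^ 2 / δ + θ ^ 2 * κ ^ 2 / s)) =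
      lam / √(r ^ 2 / δ + θ ^ 2 * κ ^ 2 / s) by
        rw [mul_assoc, mul_comm lam, mul_div_mul_left _ _ hστ.ne']]
    have hsv : s * v = κ ^ 2 := mul_div_cancel₀ _ hs0.ne'
    rw [← hsv]
    linear_combination (2 * s * σ * τ * θ *
      gaussQ (lam / √(r ^ 2 / δ + θ ^ 2 * (s * v) / s))) * hvs
  · simp_rw [← hv, hlin]
    exact (integrable_fst_mul_softThresh_gaussianReal _ _ ht).const_mul _
end
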